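/- Let m, n be positive integers and x₀ a real number with √(4 - 1/(mn)) < |x₀| ≤ 2. Define, for real y, t(y) = 2 + (y-2)(y+2-x₀²)·S_{m-1}(y)² and μ(y) = 1 + (y+2-x₀²)·S_{m-1}(y)·(S_m(y) - S_{m-1}(y)), and f(y) = S_n(t(y)) - μ(y)·S_{n-1}(t(y)). Then f has exactly one real root y in the interval (2, ∞). -/

import Mathlib

open Real

/-- Chebyshev polynomials of the second kind, nonnegative indices. -/
noncomputable def Snat (z : ℝ) : ℕ → ℝ
  | 0 => 1
  | 1 => z
  | (n+2) => z * Snat z (n+1) - Snat z n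

/-- Chebyshev polynomials of the second kind, extended to all integer indices
by the recursion `S k = z * S (k-1) - S (k-2)` (so `S (-1) = 0`, `S (-k-2) = -S k`). -/
noncomputable def S (k : ℤ) (z : ℝ) : ℝ :=
  if 0 ≤ k then Snat z k.toNat
  else if k = -1 then 0 else -Snat z (-k - 2).toNat

theorem Snat_succ2 (z : ℝ) (k : ℕ) : Snat z (k+2) = z * Snat z (k+1) - Snat z k := rfl

theorem S_coe (z : ℝ) (k : ℕ) : S (k : ℤ) z = Snat z k := by
  simp [S]

theorem Snat_cont (k : ℕ) : Continuous (fun z => Snat z k) ∧ Continuous (fun z => Snat z (k+1)) := by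
  induction k with
  | zero =>
    constructor
    · exact continuous_const
    · exact continuous_id
  | succ k ih =>
    refine ⟨ih.2, ?_⟩
    exact (continuous_id.mul ih.2).sub ih.1

theorem Snat_two (k : ℕ) : Snat 2 k = k + 1 ∧ Snat 2 (k+1) = k + 2 := by
  induction k with
  | zero => simp [Snat]
  | succ k ih =>
    refine ⟨by rw [ih.2]; push_cast; ring, ?_⟩
    rw [Snat_succ2, ih.1, ih.2]; push_cast; ring

theorem Snat_low (z : ℝ) (hz : 2 ≤ z) (k : ℕ) :
    1 ≤ Snat z k ∧ 1 ≤ Snat z (k+1) - Snat z k - (z - 2) * Snat z k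
      ∧ Snat z (k+1) ≤ z * Snat z k := by
  induction k with
  | zero => simp [Snat]; linarith
  | succ k ih =>
    obtain ⟨h1, h2, h3⟩ := ih
    have h4 : 0 ≤ (z - 2) * Snat z k := mul_nonneg (by linarith) (by linarith)
    rw [Snat_succ2]
    exact ⟨by linarith, by linarith, by linarith⟩

theorem Snat_mono (z w : ℝ) (hz : 2 ≤ z) (hw : z ≤ w) (k : ℕ) :
    Snat z k ≤ Snat w k ∧ Snat z (k+1) - Snat z k ≤ Snat w (k+1) - Snat w k := by
  induction k with
  | zero => simp [Snat]; linarith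
  | succ k ih =>
    obtain ⟨h1, h2⟩ := ih
    have h3 : Snat z (k+1) ≤ Snat w (k+1) := by linarith
    have h4 := (Snat_low z hz (k+1)).1
    have h5 : (z - 2) * Snat z (k+1) ≤ (w - 2) * Snat w (k+1) :=
      mul_le_mul (by linarith) h3 (by linarith) (by linarith)
    refine ⟨h3, ?_⟩
    rw [Snat_succ2, Snat_succ2]
    linarith

theorem Snat_quad (z : ℝ) (k : ℕ) :
    Snat z (k+1) ^ 2 - z * Snat z (k+1) * Snat z k + Snat z k ^ 2 = 1 := by
  induction k with
  | zero => simp [Snat]; ring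
  | succ k ih => rw [Snat_succ2]; linear_combination ih

theorem key_alg (u c τ M N p P : ℝ) (hu : 0 < u) (hM : 0 < M)
    (hτ : τ = u * (u + c) * M ^ 2)
    (h1 : p ^ 2 - (2 + u) * p * M + M ^ 2 = 1)
    (h2 : P ^ 2 - (2 + τ) * P * N + N ^ 2 = 1)
    (hf : P - (1 + (u + c) * M * (p - M)) * N = 0) :
    τ * (τ + c) * N ^ 2 = u := by
  have hD : (P - N) * (u * M) = τ * (p - M) * N := by
    rw [hτ]; linear_combination (u * M) * hf
  have e : τ * N ^ 2 * (τ + u * M ^ 2 * (τ - u)) = u ^ 2 * M ^ 2 := by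
    linear_combination (u^2*M^2) * h2 - τ^2*N^2 * h1
      - ((P - N) * (u * M) + τ * (p - M) * N - τ * N * u * M) * hD
  have e2 : (u * M ^ 2) * (τ * (τ + c) * N ^ 2) = (u * M ^ 2) * u := by
    linear_combination e - τ * N^2 * hτ
  exact mul_left_cancel₀ (by positivity) e2

theorem no_two (c u v τ σ M M' N N' : ℝ) (hc : 0 ≤ c) (hu : 0 < u) (huv : u < v)
    (hM : 1 ≤ M) (hMM : M ≤ M') (hN : 1 ≤ N) (hNN : τ ≤ σ → N ≤ N')
    (hτ : τ = u * (u + c) * M ^ 2) (hσ : σ = v * (v + c) * M' ^ 2)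
    (h1 : τ * (τ + c) * N ^ 2 = u) (h2 : σ * (σ + c) * N' ^ 2 = v) : False := by
  have hM2 : M ^ 2 ≤ M' ^ 2 := by gcongr
  have hMp : 0 < M ^ 2 := by positivity
  have hlt : (u + c) * M ^ 2 < (v + c) * M' ^ 2 :=
    mul_lt_mul (by linarith) hM2 hMp (by linarith)
  have hA : 0 < (u + c) * M ^ 2 := by positivity
  have hτ' : τ = u * ((u + c) * M ^ 2) := by rw [hτ]; ring
  have hσ' : σ = v * ((v + c) * M' ^ 2) := by rw [hσ]; ring
  have hτ0 : 0 < τ := by rw [hτ']; positivity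
  have hτσ : τ < σ := by
    rw [hτ', hσ']; exact mul_lt_mul huv hlt.le hA (by linarith)
  have hN2 : N ^ 2 ≤ N' ^ 2 := by
    have := hNN hτσ.le
    gcongr
  have hNp : 0 < N ^ 2 := by positivity
  have hlt2 : (τ + c) * N ^ 2 < (σ + c) * N' ^ 2 :=
    mul_lt_mul (by linarith) hN2 hNp (by linarith)
  have hB : 0 < (τ + c) * N ^ 2 := by positivity
  have e1 : ((u + c) * M ^ 2) * ((τ + c) * N ^ 2) = 1 := by
    have : u * (((u + c) * M ^ 2) * ((τ + c) * N ^ 2)) = u * 1 := by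
      linear_combination h1 - ((τ + c) * N ^ 2) * hτ'
    exact mul_left_cancel₀ hu.ne' this
  have e2 : ((v + c) * M' ^ 2) * ((σ + c) * N' ^ 2) = 1 := by
    have : v * (((v + c) * M' ^ 2) * ((σ + c) * N' ^ 2)) = v * 1 := by
      linear_combination h2 - ((σ + c) * N' ^ 2) * hσ'
    exact mul_left_cancel₀ (by linarith) this
  have := mul_lt_mul hlt hlt2.le hB (by linarith)
  linarith

theorem J2m2n_unique_root_gt_two (m n : ℕ) (hm : 1 ≤ m) (hn : 1 ≤ n) (x₀ : ℝ)
    (hx1 : Real.sqrt (4 - 1 / (m * n)) < |x₀|) (hx2 : |x₀| ≤ 2)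
    (t mu f : ℝ → ℝ)
    (ht : ∀ y, t y = 2 + (y - 2) * (y + 2 - x₀ ^ 2) * S ((m : ℤ) - 1) y ^ 2)
    (hmu : ∀ y, mu y = 1 + (y + 2 - x₀ ^ 2) * S ((m : ℤ) - 1) y *
        (S m y - S ((m : ℤ) - 1) y))
    (hf : ∀ y, f y = S n (t y) - mu y * S ((n : ℤ) - 1) (t y)) :
    ∃! y : ℝ, 2 < y ∧ f y = 0 := by
  obtain ⟨a, rfl⟩ : ∃ a, m = a + 1 := ⟨m - 1, by omega⟩
  obtain ⟨b, rfl⟩ : ∃ b, n = b + 1 := ⟨n - 1, by omega⟩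
  have ea : (((a + 1 : ℕ) : ℤ) - 1) = (a : ℤ) := by push_cast; ring
  have eb : (((b + 1 : ℕ) : ℤ) - 1) = (b : ℤ) := by push_cast; ring
  simp only [ea, eb, S_coe] at ht hmu hf
  have hc0 : 0 ≤ 4 - x₀ ^ 2 := by
    have := abs_nonneg x₀
    rw [← sq_abs]; nlinarith
  have hc1 : 4 - x₀ ^ 2 < 1 / (((a + 1 : ℕ) : ℝ) * ((b + 1 : ℕ) : ℝ)) := by
    have := Real.lt_sq_of_sqrt_lt hx1
    rw [sq_abs] at this
    linarith
  obtain ⟨c, hc⟩ : ∃ c, c = 4 - x₀ ^ 2 := ⟨_, rfl⟩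
  rw [← hc] at hc0 hc1
  have hxc : ∀ y : ℝ, y + 2 - x₀ ^ 2 = (y - 2) + c := fun y => by rw [hc]; ring
  simp only [hxc] at ht hmu
  have hMpos : ∀ y, 2 ≤ y → 1 ≤ Snat y a := fun y hy => (Snat_low y hy a).1
  have ht2 : ∀ y, 2 ≤ y → 2 ≤ t y := fun y hy => by
    rw [ht]
    have : 0 ≤ y - 2 := by linarith
    have : 0 ≤ (y - 2) * (y - 2 + c) * Snat y a ^ 2 := by positivity
    linarith
  -- continuity
  have htc : Continuous t := by
    rw [funext ht]
    have := (Snat_cont a).1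
    fun_prop
  have hmuc : Continuous mu := by
    rw [funext hmu]
    have := (Snat_cont a).1
    have := (Snat_cont a).2
    fun_prop
  have hfc : Continuous f := by
    rw [funext hf]
    exact ((Snat_cont b).2.comp htc).sub (hmuc.mul ((Snat_cont b).1.comp htc))
  have hf2 : 0 < f 2 := by
    have e : t 2 = 2 := by rw [ht]; ring
    rw [hf, e, hmu, (Snat_two a).1, (Snat_two a).2, (Snat_two b).1, (Snat_two b).2]
    rw [lt_div_iff₀ (by positivity)] at hc1
    push_cast at hc1
    linarith
  have hf4 : f 4 < 0 := by
    have hT := ht2 4 (by norm_num)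
    obtain ⟨a1, a2, a3⟩ := Snat_low 4 (by norm_num) a
    obtain ⟨b1, b2, b3⟩ := Snat_low (t 4) hT b
    have key : t 4 + 1 ≤ mu 4 := by
      rw [ht, hmu]
      have h : 2 * 1 * 1 ≤ (4 - 2 + c) * Snat 4 a *
          (Snat 4 (a+1) - Snat 4 a - (4 - 2) * Snat 4 a) := by
        have : (2:ℝ) ≤ 4 - 2 + c := by linarith
        gcongr
      linarith
    have := mul_le_mul_of_nonneg_right key (by linarith : 0 ≤ Snat (t 4) b)
    rw [hf]
    linarith
  have root : ∀ y, 2 < y → f y = 0 →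
      (t y - 2) * (t y - 2 + c) * Snat (t y) b ^ 2 = y - 2 := by
    intro y hy h0
    apply key_alg (y - 2) c (t y - 2) (Snat y a) (Snat (t y) b) (Snat y (a+1)) (Snat (t y) (b+1))
    · linarith
    · linarith [hMpos y hy.le]
    · rw [ht]; ring
    · linear_combination Snat_quad y a
    · linear_combination Snat_quad (t y) b
    · rw [← hmu, ← hf, h0]
  have uniq : ∀ y z, 2 < y → y < z → f y = 0 → f z = 0 → False := by
    intro y z hy hyz h1 h2
    refine no_two c (y - 2) (z - 2) (t y - 2) (t z - 2) (Snat y a) (Snat z a)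
      (Snat (t y) b) (Snat (t z) b) hc0 (by linarith) (by linarith) (hMpos y hy.le)
      (Snat_mono y z hy.le hyz.le a).1 (Snat_low _ (ht2 y hy.le) b).1
      (fun h => (Snat_mono _ _ (ht2 y hy.le) (by linarith) b).1)
      (by rw [ht]; ring) (by rw [ht]; ring) (root y hy h1) (root z (by linarith) h2)
  obtain ⟨y, hy, hy0⟩ := intermediate_value_Ioo' (by norm_num : (2:ℝ) ≤ 4) hfc.continuousOn
    (show (0:ℝ) ∈ Set.Ioo (f 4) (f 2) from ⟨hf4, hf2⟩)
  refine ⟨y, ⟨hy.1, hy0⟩, ?_⟩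
  rintro z ⟨hz, hz0⟩
  rcases lt_trichotomy z y with h | h | h
  · exact (uniq z y hz h hz0 hy0).elim
  · exact h
  · exact (uniq y z hy.1 h hy0 hz0).elim
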